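/- Assume T > R > P > S, 2R > T + S, 0 ≤ γ < 1 and γ² > (T−R)/(R−P). Define Q : {C,D} × Ω × Ω → ℝ by: for s1 ∈ {(C,C),(D,D)} and s2 ∈ {(C,C),(D,D)}: Q(C,s1,s2) = R/(1−γ) and Q(D,s1,s2) = T + γR + γ²P + γ³R/(1−γ); for s1 ∈ {(C,C),(D,D)} and s2 ∈ {(C,D),(D,C)}: Q(C,s1,s2) = S + γR + γ²P + γ³R/(1−γ) and Q(D,s1,s2) = P + γR/(1−γ); for s1 ∈ {(C,D),(D,C)} and s2 ∈ {(C,C),(D,D)}: Q(C,s1,s2) = R + γP + γ²R/(1−γ) and Q(D,s1,s2) = T + γP + γ²P + γ³R/(1−γ); for s1 ∈ {(C,D),(D,C)} and s2 ∈ {(C,D),(D,C)}: Q(C,s1,s2) = S + γP + γ²P + γ³R/(1−γ) and Q(D,s1,s2) = P + γP + γ²R/(1−γ). Then Q satisfies the player-1 memory-two Bellman optimality equation against the retarded WSLS strategy τ (τ(s1,s2) = C iff s2 ∈ {(C,C),(D,D)}), and τ is strictly greedy for Q: for all s1, s2, if s2 ∈ {(C,C),(D,D)} then Q(C,s1,s2)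 > Q(D,s1,s2), and if s2 ∈ {(C,D),(D,C)} then Q(D,s1,s2) > Q(C,s1,s2). -/

import Mathlib

inductive Act where
  | C : Act
  | D : Act
deriving DecidableEq

open Act

abbrev St : Type := Act × Act

/-- Player 1's payoff in the prisoner's dilemma. -/
def r1 (R S T P : ℝ) : Act → Act → ℝ
  | C, C => R
  | C, D => S
  | D, C => T
  | D, D => P

/-- Swap the roles of the two players in a state. -/
def pi' (s : St) : St := (s.2, s.1)

/-- The explicit action-value function for the retarded WSLS equilibrium. -/
noncomputable def Qwsls (R S T P γ : ℝ) (σ : Act) (s1 s2 : St) : ℝ :=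
  if s1 = (C, C) ∨ s1 = (D, D) then
    if s2 = (C, C) ∨ s2 = (D, D) then
      match σ with
      | C => R / (1 - γ)
      | D => T + γ * R + γ ^ 2 * P + γ ^ 3 * R / (1 - γ)
    else
      match σ with
      | C => S + γ * R + γ ^ 2 * P + γ ^ 3 * R / (1 - γ)
      | D => P + γ * R / (1 - γ)
  else
    if s2 = (C, C) ∨ s2 = (D, D) then
      match σ with
      | C => R + γ * P + γ ^ 2 * R / (1 - γ)
      | D => T + γ * P + γ ^ 2 * P + γ ^ 3 * R / (1 - γ)
    else
      match σ with
      | C => S + γ * P + γ ^ 2 * P + γ ^ 3 * R / (1 - γ)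
      | D => P + γ * P + γ ^ 2 * R / (1 - γ)

/-- the explicit `Qwsls` satisfies the player-1 memory-two Bellman optimality
equation against the retarded WSLS strategy, and the retarded WSLS strategy is strictly greedy
for it, whenever `γ² > (T−R)/(R−P)`. -/
theorem stmt_10 (R S T P γ : ℝ) (hTR : T > R) (hRP : R > P) (hPS : P > S)
    (h2R : 2 * R > T + S) (hγ0 : 0 ≤ γ) (hγ1 : γ < 1)
    (hγ2 : γ ^ 2 > (T - R) / (R - P))
    (τ : St → St → Act)
    (hτ : ∀ s1 s2, τ s1 s2 = if s2 = (C, C) ∨ s2 = (D, D) then C else D) :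
    (∀ σ s1 s2, Qwsls R S T P γ σ s1 s2 =
      r1 R S T P σ (τ s1 s2) +
        γ * max (Qwsls R S T P γ C (σ, τ s1 s2) s1)
          (Qwsls R S T P γ D (σ, τ s1 s2) s1)) ∧
    (∀ s1 s2 : St,
      (s2 = (C, C) ∨ s2 = (D, D) →
        Qwsls R S T P γ C s1 s2 > Qwsls R S T P γ D s1 s2) ∧
      (s2 = (C, D) ∨ s2 = (D, C) →
        Qwsls R S T P γ D s1 s2 > Qwsls R S T P γ C s1 s2)) := by
  have hTP : T - R < γ ^ 2 * (R - P) := (div_lt_iff₀ (sub_pos.mpr hRP)).mp hγ2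
  obtain ⟨K, hK⟩ : ∃ K, K = R / (1 - γ) := ⟨_, rfl⟩
  have hR : R = K * (1 - γ) := by rw [hK, div_mul_cancel₀ _ (sub_pos.mpr hγ1).ne']
  have greedy : ∀ s1 s2 : St,
      (s2 = (C, C) ∨ s2 = (D, D) →
        Qwsls R S T P γ C s1 s2 > Qwsls R S T P γ D s1 s2) ∧
      (s2 = (C, D) ∨ s2 = (D, C) →
        Qwsls R S T P γ D s1 s2 > Qwsls R S T P γ C s1 s2) := by
    rintro ⟨_ | _, _ | _⟩ ⟨_ | _, _ | _⟩ <;>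
      simp [Qwsls, mul_div_assoc, ← hK] <;>
      subst hR <;> linarith
  refine ⟨?_, greedy⟩
  intro σ s1 s2
  have hmax : max (Qwsls R S T P γ C (σ, τ s1 s2) s1) (Qwsls R S T P γ D (σ, τ s1 s2) s1) =
      Qwsls R S T P γ (if s1 = (C, C) ∨ s1 = (D, D) then C else D) (σ, τ s1 s2) s1 := by
    split_ifs with h
    · exact max_eq_left ((greedy _ _).1 h).le
    · refine max_eq_right ((greedy _ _).2 ?_).le
      rcases s1 with ⟨_ | _, _ | _⟩ <;> simp at h ⊢
  rw [hmax, hτ]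
  rcases σ with _ | _ <;> rcases s1 with ⟨_ | _, _ | _⟩ <;> rcases s2 with ⟨_ | _, _ | _⟩ <;>
    simp [Qwsls, r1, mul_div_assoc, ← hK] <;>
    subst hR <;> ring
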